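/- Let 𝐗, 𝐘, Z be pairwise disjoint node sets in a DAG D with 𝐗 and 𝐘 nonempty, and let I be a node set with forb(𝐗,𝐘,D) ⊆ I and Z ∩ I = ∅. Suppose there is a path p from 𝐗 to 𝐘 in D such that: (i) p is a proper non-causal path from 𝐗 to 𝐘; (ii) every collider on p is in An(𝐗 ∪ 𝐘 ∪ Z, D) \ I; and (iii) no non-collider on p is in Z. Then there is a proper non-causal path from 𝐗 to 𝐘 in D that is d-connecting given Z. -/

import Mathlib

attribute [local instance] Classical.propDecidable

/-- A finite directed acyclic graph on vertex type `V`. -/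
structure DAG (V : Type) [Fintype V] [DecidableEq V] where
  /-- the edge relation: `Edge a b` means there is a directed edge `a → b` -/
  Edge : V → V → Prop
  /-- there are no directed cycles -/
  acyclic : ∀ v, ¬ Relation.TransGen Edge v v

namespace DAG

variable {V : Type} [Fintype V] [DecidableEq V]

/-- two nodes are adjacent if they are joined by an edge in either direction -/
def Adj (D : DAG V) (a b : V) : Prop := D.Edge a b ∨ D.Edge b a

/-- `p` is a path from `x` to `y`: a list of distinct nodes, consecutive ones adjacent,
starting at `x` and ending at `y`. -/
def IsPathFrom (D : DAG V) (p : List V) (x y : V) : Prop :=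
  p.Nodup ∧ p.Chain' D.Adj ∧ p.head? = some x ∧ p.getLast? = some y

/-- a causal (directed) path: all edges point forward -/
def IsCausal (D : DAG V) (p : List V) : Prop := p.Chain' D.Edge

/-- descendants of a set of nodes (every node is its own descendant) -/
def Desc (D : DAG V) (S : Set V) : Set V :=
  {v | ∃ w ∈ S, Relation.ReflTransGen D.Edge w v}

/-- ancestors of a set of nodes (every node is its own ancestor) -/
def Anc (D : DAG V) (S : Set V) : Set V :=
  {v | ∃ w ∈ S, Relation.ReflTransGen D.Edge v w}

/-- `w` is a collider on the path `p`: both edges of `p` at `w` point into `w` -/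
def IsColliderOn (D : DAG V) (p : List V) (w : V) : Prop :=
  ∃ a b, [a, w, b] <:+: p ∧ D.Edge a w ∧ D.Edge b w

/-- `w` is a non-collider on `p`: a non-endpoint node of `p` that is not a collider on `p` -/
def IsNonColliderOn (D : DAG V) (p : List V) (w : V) : Prop :=
  (∃ a b, [a, w, b] <:+: p) ∧ ¬ D.IsColliderOn p w

/-- `Z` blocks the path `p`: some non-collider on `p` is in `Z`, or some collider on `p`
has no descendant in `Z`.  Otherwise `p` is d-connecting given `Z`. -/
def Blocks (D : DAG V) (Z : Set V) (p : List V) : Prop :=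
  (∃ w, D.IsNonColliderOn p w ∧ w ∈ Z) ∨
  (∃ w, D.IsColliderOn p w ∧ D.Desc {w} ∩ Z = ∅)

/-- `p` is a proper causal path from `X` to `Y` -/
def ProperCausalPath (D : DAG V) (X Y : Set V) (p : List V) : Prop :=
  (∃ x ∈ X, ∃ y ∈ Y, D.IsPathFrom p x y) ∧ (∀ v ∈ p.tail, v ∉ X) ∧ D.IsCausal p

/-- `p` is a proper non-causal path from `X` to `Y` -/
def ProperNonCausalPath (D : DAG V) (X Y : Set V) (p : List V) : Prop :=
  (∃ x ∈ X, ∃ y ∈ Y, D.IsPathFrom p x y) ∧ (∀ v ∈ p.tail, v ∉ X) ∧ ¬ D.IsCausal p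

/-- the forbidden set: all descendants of nodes `W ∉ X` lying on a proper causal path
from `X` to `Y` -/
def Forb (D : DAG V) (X Y : Set V) : Set V :=
  {v | ∃ p w, D.ProperCausalPath X Y p ∧ w ∈ p ∧ w ∉ X ∧
    Relation.ReflTransGen D.Edge w v}

/-- the adjustment criterion of Shpitser et al. / van der Zander et al. -/
def SatisfiesAC (D : DAG V) (X Y Z : Set V) : Prop :=
  Z ∩ D.Forb X Y = ∅ ∧ ∀ p, D.ProperNonCausalPath X Y p → D.Blocks Z p

/-- the constructive set `Adjust(X,Y,D)` -/
def AdjustSet (D : DAG V) (X Y : Set V) : Set V :=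
  D.Anc (X ∪ Y) \ (X ∪ Y ∪ D.Forb X Y)

/-- `Z` d-separates `X` and `Y` in `D`: `Z` blocks every path from `X` to `Y` -/
def DSep (D : DAG V) (X Y Z : Set V) : Prop :=
  ∀ x ∈ X, ∀ y ∈ Y, ∀ p, D.IsPathFrom p x y → D.Blocks Z p

/-- `p` is a back-door path from `x`: its first edge points into `x` -/
def IsBackdoorFrom (D : DAG V) (p : List V) (x : V) : Prop :=
  ∃ b rest, p = x :: b :: rest ∧ D.Edge b x

/-- Pearl's back-door criterion -/
def BackdoorCriterion (D : DAG V) (X Y Z : Set V) : Prop :=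
  Z ∩ D.Desc X = ∅ ∧
  ∀ x ∈ X, ∀ y ∈ Y, ∀ p, D.IsPathFrom p x y → D.IsBackdoorFrom p x → D.Blocks Z p

/-- the generalized back-door criterion of Maathuis and Colombo -/
def GenBackdoorCriterion (D : DAG V) (X Y Z : Set V) : Prop :=
  Z ∩ D.Desc X = ∅ ∧
  ∀ x ∈ X, ∀ y ∈ Y, ∀ p, D.IsPathFrom p x y → D.IsBackdoorFrom p x →
    D.Blocks ((Z ∪ X) \ {x}) p

end DAG


namespace DAG

variable {V : Type} [Fintype V] [DecidableEq V]

theorem not_edge_of_edge (D : DAG V) {a b : V} (h : D.Edge a b) : ¬ D.Edge b a :=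
  fun h' => D.acyclic a (.tail (.single h) h')

theorem nodup_of_isChain_edge (D : DAG V) {l : List V} (h : l.IsChain D.Edge) : l.Nodup := by
  have h1 : l.IsChain (Relation.TransGen D.Edge) := h.imp fun _ _ h => .single h
  refine (List.isChain_iff_pairwise.1 h1).imp ?_
  rintro a b hab rfl
  exact D.acyclic a hab

theorem exists_first_mem {α : Type*} {S : Set α} {p : List α} (h : ∃ c ∈ p, c ∈ S) :
    ∃ a w b, p = a ++ w :: b ∧ w ∈ S ∧ ∀ v ∈ a, v ∉ S := by
  induction p with
  | nil => simp at h
  | cons d p ih =>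
    by_cases hd : d ∈ S
    · exact ⟨[], d, p, rfl, hd, by simp⟩
    · have : ∃ c ∈ p, c ∈ S := by
        obtain ⟨c, hc, hcS⟩ := h
        rcases List.mem_cons.1 hc with rfl | hc
        · exact absurd hcS hd
        · exact ⟨c, hc, hcS⟩
      obtain ⟨a, w, b, rfl, hw, ha⟩ := ih this
      refine ⟨d :: a, w, b, rfl, hw, ?_⟩
      intro v hv
      rcases List.mem_cons.1 hv with rfl | hv
      · exact hd
      · exact ha v hv

theorem exists_last_mem {α : Type*} {S : Set α} {p : List α} (h : ∃ c ∈ p, c ∈ S) :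
    ∃ a w b, p = a ++ w :: b ∧ w ∈ S ∧ ∀ v ∈ b, v ∉ S := by
  obtain ⟨a, w, b, hp, hw, ha⟩ := exists_first_mem (p := p.reverse) (by simpa using h)
  refine ⟨b.reverse, w, a.reverse, ?_, hw, by simpa using ha⟩
  rw [← List.reverse_reverse p, hp]
  simp

/-- A triple of consecutive entries of `a ++ x :: t` has its middle entry in `a` or
its last two entries in `x :: t`. -/
theorem triple_infix_append {α : Type*} {u v w x : α} {a t : List α} (h : [u, v, w] <:+: a ++ x :: t) :
    ([u, v, w] <:+: a ++ [x] ∧ v ∈ a) ∨ [v, w] <:+: x :: t := by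
  induction a with
  | nil => exact .inr ((List.suffix_cons u [v, w]).isInfix.trans h)
  | cons c a ih =>
    rcases List.infix_cons_iff.1 h with h | h
    · cases a with
      | nil =>
        right
        rw [List.cons_prefix_cons] at h
        exact List.IsPrefix.isInfix (by simpa using h.2)
      | cons d a =>
        left
        obtain ⟨rfl, h1⟩ := List.cons_prefix_cons.1 h
        obtain ⟨rfl, h2⟩ := List.cons_prefix_cons.1 h1
        refine ⟨List.IsPrefix.isInfix ?_, by simp⟩
        cases a <;> simpa using h2
    · rcases ih h with ⟨h, hv⟩ | h
      · exact .inl ⟨List.infix_cons h, List.mem_cons_of_mem _ hv⟩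
      · exact .inr h

/-- A triple of consecutive entries of `a ++ x :: b` has its middle entry in `b` or
its first two entries in `a ++ [x]`. -/
theorem triple_infix_append_right {α : Type*} {u v w x : α} {a b : List α}
    (h : [u, v, w] <:+: a ++ x :: b) :
    ([u, v, w] <:+: x :: b ∧ v ∈ b) ∨ [u, v] <:+: a ++ [x] := by
  have h' : [w, v, u] <:+: b.reverse ++ x :: a.reverse := by
    rw [← List.reverse_infix] at h
    simpa using h
  rcases triple_infix_append h' with ⟨h, hv⟩ | h
  · left
    rw [← List.reverse_infix] at h
    exact ⟨by simpa using h, by simpa using hv⟩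
  · right
    rw [← List.reverse_infix] at h
    simpa using h

theorem nodup_triple_unique {α : Type*} {p : List α} (hp : p.Nodup) {u v w u' w' : α}
    (h : [u, v, w] <:+: p) (h' : [u', v, w'] <:+: p) : u = u' ∧ w = w' := by
  obtain ⟨s, e, rfl⟩ := h
  obtain ⟨s', e', h'⟩ := h'
  have hs : (s ++ [u]) ++ v :: (w :: e) = (s' ++ [u']) ++ v :: (w' :: e') := by
    simpa using h'.symm
  have hnd : ((s ++ [u]) ++ v :: (w :: e)).Nodup := by simpa using hp
  have h1 : v ∉ s ++ [u] := fun hv => List.disjoint_of_nodup_append hnd hv (by simp)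
  have h2 : v ∉ w :: e := (List.nodup_cons.1 hnd.of_append_right).1
  have h3 := (List.append_cons_inj_of_notMem h1 h2).1 hs
  simp_all

/-- Every node with a directed path to `T` has a directed path to `T` that meets `T`
only in its last node. -/
theorem exists_directed_path (D : DAG V) {T : Set V} {c z : V} (hz : z ∈ T)
    (h : Relation.ReflTransGen D.Edge c z) :
    ∃ l z', z' ∈ T ∧ (l ++ [z']).IsChain D.Edge ∧ (l ++ [z']).head? = some c ∧
      ∀ v ∈ l, v ∉ T := by
  induction h using Relation.ReflTransGen.head_induction_on with
  | refl => exact ⟨[], z, hz, by simp, rfl, by simp⟩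
  | @head a b hab _ ih =>
    by_cases ha : a ∈ T
    · exact ⟨[], a, ha, by simp, rfl, by simp⟩
    · obtain ⟨l, z', hz', hl, hh, hT⟩ := ih
      refine ⟨a :: l, z', hz', ?_, rfl, ?_⟩
      · rw [List.cons_append, List.isChain_cons]
        refine ⟨?_, hl⟩
        rw [hh]
        simpa using hab
      · intro v hv
        rcases List.mem_cons.1 hv with rfl | hv
        · exact ha
        · exact hT v hv

theorem reflTransGen_of_mem (D : DAG V) {l : List V} {c v : V} (hl : l.IsChain D.Edge)
    (hc : l.head? = some c) (hv : v ∈ l) : Relation.ReflTransGen D.Edge c v := by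
  induction l generalizing c with
  | nil => simp at hv
  | cons d l ih =>
    obtain rfl : d = c := by simpa using hc
    rcases List.mem_cons.1 hv with rfl | hv
    · exact .refl
    · cases l with
      | nil => simp at hv
      | cons e l =>
        rw [List.isChain_cons_cons] at hl
        exact .head hl.1 (ih hl.2 rfl hv)

/-- A path entered along an edge `u → w` stays directed from `w` on, as long as no
descendant of `w` is a collider. -/
theorem isChain_edge_of_no_collider (D : DAG V) {b : List V} {u w : V}
    (h : (u :: w :: b).IsChain D.Adj) (huw : D.Edge u w)
    (hcol : ∀ v, Relation.ReflTransGen D.Edge w v → ¬ D.IsColliderOn (u :: w :: b) v) :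
    (w :: b).IsChain D.Edge := by
  induction b generalizing u w with
  | nil => simp
  | cons d b ih =>
    simp only [List.isChain_cons_cons] at h
    have hwd : D.Edge w d := by
      rcases h.2.1 with h' | h'
      · exact h'
      · exact absurd ⟨u, d, List.IsPrefix.isInfix ⟨b, rfl⟩, huw, h'⟩ (hcol w .refl)
    rw [List.isChain_cons_cons]
    refine ⟨hwd, ih (u := w) (by simpa using h.2) hwd ?_⟩
    rintro v hv ⟨s, e, hse, h1, h2⟩
    exact hcol v (.head hwd hv) ⟨s, e, List.infix_cons hse, h1, h2⟩

/-- Rerouting at a collider `c` towards `X`: the new path follows, backwards, a directed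
path from `c` to `X` and then the old path. -/
theorem exists_reroute_start (D : DAG V) {X Y Z : Set V} {p : List V} {c : V}
    (hp : D.ProperNonCausalPath X Y p)
    (hnc : ∀ u v w, [u, v, w] <:+: p → v ∈ Z → D.Edge u v ∧ D.Edge w v)
    (hc : c ∈ p.tail) {l : List V} {x' : V} (hx' : x' ∈ X)
    (hl : (l ++ [x']).IsChain D.Edge) (hhead : (l ++ [x']).head? = some c)
    (hlX : ∀ v ∈ l, v ∉ X) (hlZ : ∀ v ∈ l ++ [x'], v ∉ Z) :
    ∃ q, D.ProperNonCausalPath X Y q ∧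
      (∀ u v w, [u, v, w] <:+: q → v ∈ Z → D.Edge u v ∧ D.Edge w v) ∧
      ∀ v, D.IsColliderOn q v → D.IsColliderOn p v ∧ v ≠ c := by
  obtain ⟨⟨x, hx, y, hy, hnd, hch, hph, hpl⟩, hprop, -⟩ := hp
  have hcS : c ∈ l ++ [x'] := List.mem_of_mem_head? (by simp [hhead])
  obtain ⟨a, W, b, rfl, hW, hb⟩ := exists_last_mem (S := {v | v ∈ l ++ [x']}) (p := p)
    ⟨c, List.mem_of_mem_tail hc, hcS⟩
  have ha : a ≠ [] := by
    rintro rfl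
    exact hb c hc hcS
  obtain ⟨a0, a', rfl⟩ := List.exists_cons_of_ne_nil ha
  have hWX : W ∉ X := hprop W (by simp)
  have hWl : W ∈ l := by
    rcases List.mem_append.1 hW with h | h
    · exact h
    · exact absurd hx' (by simpa [List.mem_singleton.1 h] using hWX)
  obtain ⟨s, t, rfl⟩ := List.append_of_mem hWl
  have hchain : (W :: t ++ [x']).IsChain D.Edge :=
    hl.infix ⟨s, [], by simp⟩
  have hrev : (x' :: t.reverse ++ [W]).IsChain (fun a b => D.Edge b a) := by
    have := List.isChain_reverse.2 hchain
    simpa using this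
  have hsub : ∀ v ∈ x' :: t.reverse ++ [W], v ∈ (s ++ W :: t) ++ [x'] := by
    intro v hv
    simp at hv ⊢
    tauto
  refine ⟨(x' :: t.reverse) ++ W :: b, ⟨⟨x', hx', y, hy, ?_, ?_, rfl, ?_⟩, ?_, ?_⟩, ?_, ?_⟩
  · have h1 : (x' :: t.reverse ++ [W]).Nodup := by
      have := List.nodup_reverse.2 (D.nodup_of_isChain_edge hchain)
      simpa using this
    have h2 : b.Nodup := hnd.sublist ((List.suffix_cons W b).sublist.trans
      (List.sublist_append_right _ _))
    have := h1.append h2 fun v hv hv' => hb v hv' (hsub v hv)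
    simpa using this
  · have h1 : (x' :: t.reverse ++ [W]).IsChain D.Adj := hrev.imp fun _ _ h => .inr h
    have h2 : (W :: b).IsChain D.Adj := hch.suffix (List.suffix_append _ _)
    exact List.isChain_split.2 ⟨h1, h2⟩
  · rw [List.getLast?_append_cons] at hpl ⊢
    exact hpl
  · intro v hv
    simp only [List.cons_append, List.tail_cons, List.mem_append, List.mem_reverse,
      List.mem_cons] at hv
    rcases hv with hv | rfl | hv
    · exact hlX v (by simp [hv])
    · exact hWX
    · exact hprop v (by simp [hv])
  · intro hcau
    have h1 : (x' :: t.reverse ++ [W]).IsChain D.Edge := (List.isChain_split.1 hcau).1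
    revert h1 hrev
    generalize t.reverse = r
    intro h1 h2
    cases r <;> simp only [List.cons_append, List.nil_append, List.isChain_cons_cons] at h1 h2 <;>
      exact D.not_edge_of_edge h1.1 h2.1
  · intro u v w huvw hv
    rcases triple_infix_append_right huvw with ⟨h, -⟩ | h
    · exact hnc u v w (h.trans (List.suffix_append _ _).isInfix) hv
    · exact absurd hv (hlZ v (hsub v (h.subset (by simp))))
  · rintro v ⟨u, w, huvw, h1, h2⟩
    rcases triple_infix_append_right huvw with ⟨h, hvb⟩ | h
    · refine ⟨⟨u, w, h.trans (List.suffix_append _ _).isInfix, h1, h2⟩, ?_⟩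
      rintro rfl
      exact hb v hvb hcS
    · have := hrev.infix h
      exact absurd h1 (D.not_edge_of_edge (by simpa using this))

/-- Rerouting at a collider `c` towards `Y`: the new path follows the old path and then
a directed path from `c` to `Y`. -/
theorem exists_reroute_end (D : DAG V) {X Y Z : Set V} {p : List V} {c : V}
    (hp : D.ProperNonCausalPath X Y p)
    (hnc : ∀ u v w, [u, v, w] <:+: p → v ∈ Z → D.Edge u v ∧ D.Edge w v)
    (hcol : ∀ w, D.IsColliderOn p w → w ∉ D.Forb X Y)
    (hc : c ∈ p) {l : List V} {y' : V} (hy' : y' ∈ Y)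
    (hl : (l ++ [y']).IsChain D.Edge) (hhead : (l ++ [y']).head? = some c)
    (hlX : ∀ v ∈ l ++ [y'], v ∉ X) (hlZ : ∀ v ∈ l ++ [y'], v ∉ Z) :
    ∃ q, D.ProperNonCausalPath X Y q ∧
      (∀ u v w, [u, v, w] <:+: q → v ∈ Z → D.Edge u v ∧ D.Edge w v) ∧
      ∀ v, D.IsColliderOn q v → D.IsColliderOn p v ∧ v ≠ c := by
  obtain ⟨⟨x, hx, y, hy, hnd, hch, hph, hpl⟩, hprop, hncau⟩ := hp
  have hcS : c ∈ l ++ [y'] := List.mem_of_mem_head? (by simp [hhead])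
  obtain ⟨a, W, b, rfl, hW, ha⟩ := exists_first_mem (S := {v | v ∈ l ++ [y']}) (p := p)
    ⟨c, hc, hcS⟩
  have hWX : W ∉ X := hlX W hW
  obtain ⟨a', u, rfl⟩ : ∃ a' u, a = a' ++ [u] := by
    rcases List.eq_nil_or_concat a with rfl | h
    · obtain rfl : W = x := by simpa using hph
      exact absurd hx hWX
    · simpa using h
  obtain ⟨s, t, hst⟩ := List.append_of_mem hW
  have hsub : ∀ v ∈ W :: t, v ∈ l ++ [y'] := fun v hv => by rw [hst]; simp_all
  have hchain : (W :: t).IsChain D.Edge :=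
    hl.suffix (hst ▸ List.suffix_append _ _)
  have hlast : (W :: t).getLast? = some y' := by
    have : (l ++ [y']).getLast? = some y' := by simp
    rw [hst] at this
    simpa using this
  have hpath : D.IsPathFrom ((a' ++ [u]) ++ W :: t) x y' := by
    refine ⟨?_, ?_, ?_, ?_⟩
    · refine List.Nodup.append ?_ (D.nodup_of_isChain_edge hchain) ?_
      · exact hnd.sublist (List.sublist_append_left _ _)
      · exact fun v hv hv' => ha v hv (hsub v hv')
    · refine List.isChain_split.2 ⟨(List.isChain_split.1 hch).1, ?_⟩
      exact hchain.imp fun _ _ h => .inl h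
    · cases a' <;> simpa using hph
    · simpa using hlast
  have hproper : ∀ v ∈ ((a' ++ [u]) ++ W :: t).tail, v ∉ X := by
    intro v hv
    have : v ∈ (a' ++ [u]).tail ∨ v ∈ W :: t := by
      rwa [List.tail_append_of_ne_nil (by simp), List.mem_append] at hv
    rcases this with h | h
    · refine hprop v ?_
      rw [List.tail_append_of_ne_nil (by simp)]
      exact List.mem_append_left _ h
    · exact hlX v (hsub v h)
  refine ⟨(a' ++ [u]) ++ W :: t, ⟨⟨x, hx, y', hy', hpath⟩, hproper, ?_⟩, ?_, ?_⟩
  · intro hcau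
    have h1 : ((a' ++ [u]) ++ [W]).IsChain D.Edge := (List.isChain_split.1 hcau).1
    have huW : D.Edge u W := by
      have : [u, W].IsChain D.Edge := h1.infix ⟨a', [], by simp⟩
      simpa using this
    have hsuf : u :: W :: b <:+ (a' ++ [u]) ++ W :: b := ⟨a', by simp⟩
    have h2 : (W :: b).IsChain D.Edge := by
      refine D.isChain_edge_of_no_collider (hch.suffix hsuf) huW ?_
      rintro v hv ⟨d, e, hde, hd, he⟩
      exact hcol v ⟨d, e, hde.trans hsuf.isInfix, hd, he⟩
        ⟨_, W, ⟨⟨x, hx, y', hy', hpath⟩, hproper, hcau⟩, by simp, hWX, hv⟩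
    exact hncau (List.isChain_split.2 ⟨h1, h2⟩)
  · intro d v w hdvw hv
    rcases triple_infix_append hdvw with ⟨h, -⟩ | h
    · exact hnc d v w (h.trans ⟨[], b, by simp⟩) hv
    · exact absurd hv (hlZ v (hsub v (h.subset (by simp))))
  · rintro v ⟨d, w, hdvw, h1, h2⟩
    rcases triple_infix_append hdvw with ⟨h, hva⟩ | h
    · refine ⟨⟨d, w, h.trans ⟨[], b, by simp⟩, h1, h2⟩, ?_⟩
      rintro rfl
      exact ha v hva hcS
    · have := hchain.infix h
      exact absurd h2 (D.not_edge_of_edge (by simpa using this))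

theorem IsColliderOn.mem_tail {D : DAG V} {p : List V} {c : V} (h : D.IsColliderOn p c) :
    c ∈ p.tail := by
  obtain ⟨a, b, ⟨s, e, rfl⟩, -, -⟩ := h
  cases s <;> simp

/-- Let `I ⊇ forb(X,Y,D)` with `Z ∩ I = ∅`.  If `p` is a proper
non-causal path from `X` to `Y` all of whose colliders are in `An(X ∪ Y ∪ Z, D) \ I`
and none of whose non-colliders is in `Z`, then some proper non-causal path from `X`
to `Y` is d-connecting given `Z` in `D`. -/
theorem connecting_path_lemma
    (D : DAG V) (X Y Z I : Set V)
    (hXY : Disjoint X Y) (hXZ : Disjoint X Z) (hYZ : Disjoint Y Z)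
    (hX : X.Nonempty) (hY : Y.Nonempty)
    (hforb : D.Forb X Y ⊆ I) (hZI : Z ∩ I = ∅)
    (p : List V)
    (hp : D.ProperNonCausalPath X Y p)
    (hcol : ∀ w, D.IsColliderOn p w → w ∈ D.Anc (X ∪ Y ∪ Z) \ I)
    (hnoncol : ∀ w, D.IsNonColliderOn p w → w ∉ Z) :
    ∃ q, D.ProperNonCausalPath X Y q ∧ ¬ D.Blocks Z q := by
  have hnc : ∀ u v w, [u, v, w] <:+: p → v ∈ Z → D.Edge u v ∧ D.Edge w v := by
    intro u v w huvw hv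
    by_contra hcon
    refine hnoncol v ⟨⟨u, w, huvw⟩, ?_⟩ hv
    rintro ⟨u', w', h', h1, h2⟩
    obtain ⟨⟨_, _, _, _, hnd, _⟩, _⟩ := hp
    obtain ⟨rfl, rfl⟩ := nodup_triple_unique hnd huvw h'
    exact hcon ⟨h1, h2⟩
  clear hnoncol
  induction hn : {w | D.IsColliderOn p w}.ncard using Nat.strong_induction_on generalizing p with
  | _ n ih =>
  subst hn
  by_cases hall : ∀ w, D.IsColliderOn p w → w ∈ D.Anc Z
  · refine ⟨p, hp, ?_⟩
    rintro (⟨w, ⟨⟨a, b, hab⟩, hw⟩, hwZ⟩ | ⟨w, hw, hwZ⟩)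
    · exact hw ⟨a, b, hab, hnc a w b hab hwZ⟩
    · obtain ⟨z, hz, hwz⟩ := hall w hw
      exact Set.eq_empty_iff_forall_notMem.1 hwZ z ⟨⟨w, rfl, hwz⟩, hz⟩
  · push Not at hall
    obtain ⟨c, hc, hcZ⟩ := hall
    suffices h : ∃ q, D.ProperNonCausalPath X Y q ∧
        (∀ u v w, [u, v, w] <:+: q → v ∈ Z → D.Edge u v ∧ D.Edge w v) ∧
        ∀ v, D.IsColliderOn q v → D.IsColliderOn p v ∧ v ≠ c by
      obtain ⟨q, hq, hqnc, hqcol⟩ := h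
      refine ih _ (Set.ncard_lt_ncard ?_ (Set.toFinite _)) q hq
        (fun w hw => hcol w (hqcol w hw).1) hqnc rfl
      exact ⟨fun w hw => (hqcol w hw).1, fun h => (hqcol c (h hc)).2 rfl⟩
    obtain ⟨z, hz, hcz⟩ := (hcol c hc).1
    have hz : z ∈ X ∪ Y := by
      rcases hz with hz | hz
      · exact hz
      · exact absurd ⟨z, hz, hcz⟩ hcZ
    obtain ⟨l, z', hz', hl, hhead, hlT⟩ := D.exists_directed_path hz hcz
    have hlZ : ∀ v ∈ l ++ [z'], v ∉ Z := fun v hv hvZ =>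
      hcZ ⟨v, hvZ, D.reflTransGen_of_mem hl hhead hv⟩
    have hlX : ∀ v ∈ l, v ∉ X := fun v hv hvX => hlT v hv (.inl hvX)
    rcases hz' with hz' | hz'
    · exact D.exists_reroute_start hp hnc hc.mem_tail hz' hl hhead hlX hlZ
    · refine D.exists_reroute_end hp hnc (fun w hw hwF => (hcol w hw).2 (hforb hwF))
        (List.mem_of_mem_tail hc.mem_tail) hz' hl hhead ?_ hlZ
      intro v hv
      rcases List.mem_append.1 hv with hv | hv
      · exact hlX v hv
      · obtain rfl := List.mem_singleton.1 hv
        exact Set.disjoint_right.1 hXY hz'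

end DAG
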